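/- Let a > 0 and let V : ℝ → ℂ be continuous with ∫_ℝ e^{4a|x|}|V(x)|² dx < ∞ (i.e. e^{2a|x|}V ∈ L²(ℝ)). Let t ∈ ℂ with t ≠ 0 and |Re t| < a, and set λ = −t². Let ν₁, ν₂ : ℝ → ℂ be twice continuously differentiable solutions of μ'' + (λ − V(x))μ = 0 with ν₁(0) = 1, ν₁'(0) = 0, ν₂(0) = 0, ν₂'(0) = 1, and suppose there is a constant C with |νᵢ(x)| + |νᵢ'(x)| ≤ C e^{|Re t|·|x|} for all x ∈ ℝ and i = 1,2. Then 𝔻(λ, ν₁, ν₂) is well defined, and 𝔻(λ, ν₁, ν₂) = 0 if and only if there exists a continuous function μ : ℝ → ℂ, not identically zero, with ∫_ℝ |μ(x)|² e^{−2a|x|} dx < ∞, satisfying for every x ∈ ℝ the integral equation μ(x) = −(1/(2t))∫_x^∞ e^{−t(y−x)}V(y)μ(y) dy − (1/(2t))∫_{−∞}^x e^{t(y−x)}V(y)μ(y) dy. (Such a μ is a generalized eigenfunction, and λ is then a generalized eigenvalue, of −d²/dx² + V.) -/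

import Mathlib

open MeasureTheory Set Filter

/-- `D t V μ x = μ(x) + (1/(2t)) ∫_x^∞ e^{-t(y-x)} V(y) μ(y) dy
    + (1/(2t)) ∫_{-∞}^x e^{t(y-x)} V(y) μ(y) dy`, where `t = √(-λ)`. -/
noncomputable def D (t : ℂ) (V μ : ℝ → ℂ) (x : ℝ) : ℂ :=
  μ x + (1 / (2 * t)) * (∫ y in Ici x, Complex.exp (-t * ((y : ℂ) - (x : ℂ))) * V y * μ y)
      + (1 / (2 * t)) * (∫ y in Iic x, Complex.exp (t * ((y : ℂ) - (x : ℂ))) * V y * μ y)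

/-- `𝔻(λ, μ₁, μ₂) = D(0,λ,μ₁) D'(0,λ,μ₂) - D'(0,λ,μ₁) D(0,λ,μ₂)`. -/
noncomputable def DD (t : ℂ) (V μ₁ μ₂ : ℝ → ℂ) : ℂ :=
  D t V μ₁ 0 * deriv (D t V μ₂) 0 - deriv (D t V μ₁) 0 * D t V μ₂ 0

/-- `(μ, μ')` is a classical solution of `-μ'' + V μ = -t² μ`, written as a first-order system. -/
def IsSolution (t : ℂ) (V μ μ' : ℝ → ℂ) : Prop :=
  ∀ x : ℝ, HasDerivAt μ (μ' x) x ∧ HasDerivAt μ' ((V x + t ^ 2) * μ x) x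

/-- The integrability under which `D t V μ` is well defined. -/
def IsAdmissible (t : ℂ) (V μ : ℝ → ℂ) : Prop :=
  (∀ x : ℝ, IntegrableOn (fun y : ℝ => Complex.exp (-t * y) * V y * μ y) (Ici x)) ∧
  (∀ x : ℝ, IntegrableOn (fun y : ℝ => Complex.exp (t * y) * V y * μ y) (Iic x))

/-- The half `e^{tx} ∫_x^∞ e^{-ty} V μ` of the resolvent integral. -/
noncomputable def rightPart (t : ℂ) (V μ : ℝ → ℂ) (x : ℝ) : ℂ :=
  Complex.exp (t * x) * ∫ y in Ici x, Complex.exp (-t * y) * V y * μ y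

/-- The half `e^{-tx} ∫_{-∞}^x e^{ty} V μ` of the resolvent integral. -/
noncomputable def leftPart (t : ℂ) (V μ : ℝ → ℂ) (x : ℝ) : ℂ :=
  Complex.exp (-t * x) * ∫ y in Iic x, Complex.exp (t * y) * V y * μ y

theorem eq_of_hasDerivAt_zero {f : ℝ → ℂ} (h : ∀ x, HasDerivAt f 0 x) (x y : ℝ) : f x = f y :=
  is_const_of_deriv_eq_zero (fun x => (h x).differentiableAt) (fun x => (h x).deriv) x y

theorem hasDerivAt_integral_Ici {f : ℝ → ℂ} (hf : Continuous f)
    (hi : ∀ x, IntegrableOn f (Ici x)) (x : ℝ) :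
    HasDerivAt (fun x => ∫ y in Ici x, f y) (-f x) x := by
  have h : (fun x => ∫ y in Ici x, f y) =
      fun x => (∫ y in Ioi 0, f y) - ∫ y in (0 : ℝ)..x, f y := by
    funext z
    rw [integral_Ici_eq_integral_Ioi,
      ← intervalIntegral.integral_Ioi_sub_Ioi' ((hi 0).mono_set Ioi_subset_Ici_self)
        ((hi z).mono_set Ioi_subset_Ici_self)]
    ring
  rw [h]
  exact (hf.integral_hasStrictDerivAt 0 x).hasDerivAt.const_sub _

theorem hasDerivAt_integral_Iic {f : ℝ → ℂ} (hf : Continuous f)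
    (hi : ∀ x, IntegrableOn f (Iic x)) (x : ℝ) :
    HasDerivAt (fun x => ∫ y in Iic x, f y) (f x) x := by
  have h : (fun x => ∫ y in Iic x, f y) =
      fun x => (∫ y in Iic 0, f y) + ∫ y in (0 : ℝ)..x, f y := by
    funext z
    rw [← intervalIntegral.integral_Iic_sub_Iic (hi 0) (hi z)]
    ring
  rw [h]
  exact (hf.integral_hasStrictDerivAt 0 x).hasDerivAt.const_add _

theorem hasDerivAt_exp_mul (t : ℂ) (x : ℝ) :
    HasDerivAt (fun x : ℝ => Complex.exp (t * x)) (Complex.exp (t * x) * t) x := by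
  simpa using (((hasDerivAt_id (x : ℂ)).const_mul t).cexp).comp_ofReal

theorem exp_mul_exp_neg (t : ℂ) (x : ℝ) : Complex.exp (t * x) * Complex.exp (-t * x) = 1 := by
  rw [← Complex.exp_add]; simp

theorem hasDerivAt_rightPart {t : ℂ} {V μ : ℝ → ℂ} (hV : Continuous V) (hμ : Continuous μ)
    (hi : IsAdmissible t V μ) (x : ℝ) :
    HasDerivAt (rightPart t V μ) (t * rightPart t V μ x - V x * μ x) x := by
  have hc : Continuous fun y : ℝ => Complex.exp (-t * y) * V y * μ y := by fun_prop
  refine ((hasDerivAt_exp_mul t x).mul (hasDerivAt_integral_Ici hc hi.1 x)).congr_deriv ?_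
  rw [rightPart]
  linear_combination (-(V x * μ x)) * exp_mul_exp_neg t x

theorem hasDerivAt_leftPart {t : ℂ} {V μ : ℝ → ℂ} (hV : Continuous V) (hμ : Continuous μ)
    (hi : IsAdmissible t V μ) (x : ℝ) :
    HasDerivAt (leftPart t V μ) (-t * leftPart t V μ x + V x * μ x) x := by
  have hc : Continuous fun y : ℝ => Complex.exp (t * y) * V y * μ y := by fun_prop
  refine ((hasDerivAt_exp_mul (-t) x).mul (hasDerivAt_integral_Iic hc hi.2 x)).congr_deriv ?_
  rw [leftPart]
  linear_combination (V x * μ x) * exp_mul_exp_neg t x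

theorem setIntegral_exp_sub (s : ℂ) (V μ : ℝ → ℂ) (S : Set ℝ) (x : ℝ) :
    (∫ y in S, Complex.exp (s * ((y : ℂ) - (x : ℂ))) * V y * μ y) =
      Complex.exp (-s * x) * ∫ y in S, Complex.exp (s * y) * V y * μ y := by
  rw [← integral_const_mul]
  congr 1
  funext y
  rw [show s * ((y : ℂ) - x) = -s * x + s * y by ring, Complex.exp_add]
  ring

theorem D_eq (t : ℂ) (V μ : ℝ → ℂ) (x : ℝ) :
    D t V μ x = μ x + (1 / (2 * t)) * (rightPart t V μ x + leftPart t V μ x) := by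
  rw [D, setIntegral_exp_sub, setIntegral_exp_sub, rightPart, leftPart, neg_neg]
  ring

theorem hasDerivAt_D {t : ℂ} (ht : t ≠ 0) {V μ : ℝ → ℂ} {m : ℂ} {x : ℝ} (hV : Continuous V)
    (hμ : Continuous μ) (hi : IsAdmissible t V μ) (hd : HasDerivAt μ m x) :
    HasDerivAt (D t V μ) (m + (rightPart t V μ x - leftPart t V μ x) / 2) x := by
  rw [show D t V μ = _ from funext (D_eq t V μ)]
  refine (hd.add (((hasDerivAt_rightPart hV hμ hi x).add
    (hasDerivAt_leftPart hV hμ hi x)).const_mul (1 / (2 * t)))).congr_deriv ?_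
  field_simp
  ring

theorem D_linear {t : ℂ} {V μ ν : ℝ → ℂ} (hμ : IsAdmissible t V μ) (hν : IsAdmissible t V ν)
    (b c : ℂ) (x : ℝ) :
    D t V (fun y => b * μ y + c * ν y) x = b * D t V μ x + c * D t V ν x := by
  have h (s : ℂ) (S : Set ℝ) (h₁ : IntegrableOn (fun y : ℝ => Complex.exp (s * y) * V y * μ y) S)
      (h₂ : IntegrableOn (fun y : ℝ => Complex.exp (s * y) * V y * ν y) S) :
      (∫ y in S, Complex.exp (s * y) * V y * (b * μ y + c * ν y)) =
        b * (∫ y in S, Complex.exp (s * y) * V y * μ y) +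
          c * ∫ y in S, Complex.exp (s * y) * V y * ν y := by
    rw [← integral_const_mul, ← integral_const_mul,
      ← integral_add (h₁.const_mul b) (h₂.const_mul c)]
    congr 1
    funext y
    ring
  simp only [D_eq, rightPart, leftPart]
  rw [h _ _ (hμ.1 x) (hν.1 x), h _ _ (hμ.2 x) (hν.2 x)]
  ring

theorem IsAdmissible.linear {t : ℂ} {V μ ν : ℝ → ℂ} (hμ : IsAdmissible t V μ)
    (hν : IsAdmissible t V ν) (b c : ℂ) : IsAdmissible t V (fun y => b * μ y + c * ν y) := by
  constructor <;> intro x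
  · refine (((hμ.1 x).const_mul b).add ((hν.1 x).const_mul c)).congr (ae_of_all _ fun y => ?_)
    simp only [Pi.add_apply]
    ring
  · refine (((hμ.2 x).const_mul b).add ((hν.2 x).const_mul c)).congr (ae_of_all _ fun y => ?_)
    simp only [Pi.add_apply]
    ring

theorem IsSolution.continuous {t : ℂ} {V μ μ' : ℝ → ℂ} (h : IsSolution t V μ μ') :
    Continuous μ :=
  continuous_iff_continuousAt.2 fun x => (h x).1.continuousAt

theorem IsSolution.linear {t : ℂ} {V μ μ' ν ν' : ℝ → ℂ} (hμ : IsSolution t V μ μ')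
    (hν : IsSolution t V ν ν') (b c : ℂ) :
    IsSolution t V (fun y => b * μ y + c * ν y) (fun y => b * μ' y + c * ν' y) := fun x =>
  ⟨((hμ x).1.const_mul b).add ((hν x).1.const_mul c),
    (((hμ x).2.const_mul b).add ((hν x).2.const_mul c)).congr_deriv (by ring)⟩

theorem IsSolution.wronskian_eq {t : ℂ} {V μ μ' ν ν' : ℝ → ℂ} (hμ : IsSolution t V μ μ')
    (hν : IsSolution t V ν ν') (x y : ℝ) :
    μ x * ν' x - μ' x * ν x = μ y * ν' y - μ' y * ν y :=
  eq_of_hasDerivAt_zero (f := fun x => μ x * ν' x - μ' x * ν x) (fun x =>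
    (((hμ x).1.mul (hν x).2).sub ((hμ x).2.mul (hν x).1)).congr_deriv (by ring)) x y

/-- Every solution is a combination of the fundamental system normalised at `0`. -/
theorem IsSolution.eq_linear {t : ℂ} {V μ μ' ν₁ ν₁' ν₂ ν₂' : ℝ → ℂ} (hμ : IsSolution t V μ μ')
    (h₁ : IsSolution t V ν₁ ν₁') (h₂ : IsSolution t V ν₂ ν₂')
    (hi₁ : ν₁ 0 = 1 ∧ ν₁' 0 = 0) (hi₂ : ν₂ 0 = 0 ∧ ν₂' 0 = 1) (x : ℝ) :
    μ x = μ 0 * ν₁ x + μ' 0 * ν₂ x := by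
  have e₁ := hμ.wronskian_eq h₁ x 0
  have e₂ := hμ.wronskian_eq h₂ x 0
  have e := h₁.wronskian_eq h₂ x 0
  rw [hi₁.1, hi₁.2] at e₁ e
  rw [hi₂.1, hi₂.2] at e₂ e
  linear_combination ν₁ x * e₂ - ν₂ x * e₁ - μ x * e

/-- For a solution `μ`, `D t V μ` solves the free equation, hence vanishes with its Cauchy data. -/
theorem IsSolution.D_eq_zero {t : ℂ} (ht : t ≠ 0) {V μ μ' : ℝ → ℂ} (hV : Continuous V)
    (hμ : IsSolution t V μ μ') (hi : IsAdmissible t V μ) (h₀ : D t V μ 0 = 0)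
    (h₁ : deriv (D t V μ) 0 = 0) (x : ℝ) : D t V μ x = 0 := by
  set E : ℝ → ℂ := fun x => μ' x + (rightPart t V μ x - leftPart t V μ x) / 2
  have hD (x : ℝ) : HasDerivAt (D t V μ) (E x) x :=
    hasDerivAt_D ht hV hμ.continuous hi (hμ x).1
  have hE' (x : ℝ) : HasDerivAt E (t ^ 2 * D t V μ x) x := by
    refine ((hμ x).2.add (((hasDerivAt_rightPart hV hμ.continuous hi x).sub
      (hasDerivAt_leftPart hV hμ.continuous hi x)).div_const 2)).congr_deriv ?_
    rw [D_eq]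
    field_simp
    ring
  have hE0 : E 0 = 0 := (hD 0).deriv ▸ h₁
  have key (s : ℂ) (hs : s ^ 2 = t ^ 2) : E x + s * D t V μ x = 0 := by
    have h := eq_of_hasDerivAt_zero (f := fun x => Complex.exp (-s * x) * (E x + s * D t V μ x))
      (fun x => ((hasDerivAt_exp_mul (-s) x).mul
        ((hE' x).add ((hD x).const_mul s))).congr_deriv
          (by rw [← hs]; simp only [Pi.add_apply]; ring)) x 0
    simpa [hE0, h₀, Complex.exp_ne_zero] using h
  have hp := key t rfl
  have hm := key (-t) (by ring)
  have : (2 * t) * D t V μ x = 0 := by linear_combination hp - hm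
  exact (mul_eq_zero.1 this).resolve_left (mul_ne_zero two_ne_zero ht)

/-- A continuous solution of the integral equation is a classical solution. -/
theorem isSolution_of_D_eq_zero {t : ℂ} (ht : t ≠ 0) {V μ : ℝ → ℂ} (hV : Continuous V)
    (hμ : Continuous μ) (hi : IsAdmissible t V μ) (h : ∀ x, D t V μ x = 0) :
    IsSolution t V μ (fun x => -((rightPart t V μ x - leftPart t V μ x) / 2)) := by
  have hμe (x : ℝ) : μ x = -(1 / (2 * t)) * (rightPart t V μ x + leftPart t V μ x) := by
    linear_combination h x - D_eq t V μ x
  intro x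
  have hr := hasDerivAt_rightPart hV hμ hi x
  have hl := hasDerivAt_leftPart hV hμ hi x
  constructor
  · have := (hr.add hl).const_mul (-(1 / (2 * t)))
    refine (this.congr_of_eventuallyEq (Eventually.of_forall hμe)).congr_deriv ?_
    field_simp
    ring
  · refine ((hr.sub hl).div_const 2).neg.congr_deriv ?_
    have := hμe x
    field_simp at this
    linear_combination -t * this / 2

theorem exists_linear_eq_zero {p q r s : ℂ} (h : p * s - r * q = 0) :
    ∃ b c : ℂ, (b ≠ 0 ∨ c ≠ 0) ∧ b * p + c * q = 0 ∧ b * r + c * s = 0 := by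
  by_cases hpq : q = 0 ∧ p = 0
  · by_cases hrs : s = 0 ∧ r = 0
    · exact ⟨1, 0, by simp, by simp [hpq.2], by simp [hrs.2]⟩
    · exact ⟨s, -r, by rwa [neg_ne_zero, ← not_and_or], by simp [hpq.1, hpq.2], by ring⟩
  · exact ⟨q, -p, by rwa [neg_ne_zero, ← not_and_or], by ring, by linear_combination -h⟩

theorem integrable_exp_neg_mul_abs {b : ℝ} (hb : 0 < b) :
    Integrable fun x : ℝ => Real.exp (-b * |x|) := by
  rw [← integrableOn_univ, ← Iic_union_Ioi (a := (0 : ℝ))]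
  refine IntegrableOn.union ?_ ?_
  · exact (integrableOn_exp_mul_Iic hb 0).congr_fun
      (fun x hx => by simp only [abs_of_nonpos (mem_Iic.1 hx), neg_mul_neg]) measurableSet_Iic
  · exact (integrableOn_exp_mul_Ioi (neg_lt_zero.2 hb) 0).congr_fun
      (fun x hx => by simp only [abs_of_pos (mem_Ioi.1 hx)]) measurableSet_Ioi

theorem norm_exp_mul_le (s : ℂ) (y : ℝ) : ‖Complex.exp (s * y)‖ ≤ Real.exp (|s.re| * |y|) := by
  rw [Complex.norm_exp, Real.exp_le_exp, Complex.re_mul_ofReal, ← abs_mul]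
  exact le_abs_self _

theorem integrable_exp_mul_of_growth {a : ℝ} {V μ : ℝ → ℂ} {s : ℂ} {C : ℝ} (hV : Continuous V)
    (hμ : Continuous μ) (hVL2 : Integrable fun x : ℝ => Real.exp (4 * a * |x|) * ‖V x‖ ^ 2)
    (hs : |s.re| < a) (hC : ∀ x, ‖μ x‖ ≤ C * Real.exp (|s.re| * |x|)) :
    Integrable fun y : ℝ => Complex.exp (s * y) * V y * μ y := by
  have hC0 : 0 ≤ C := by simpa using (norm_nonneg _).trans (hC 0)
  have hb : 0 < 4 * (a - |s.re|) := by linarith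
  refine ((hVL2.add (integrable_exp_neg_mul_abs hb)).const_mul C).mono'
    (by fun_prop) (ae_of_all _ fun y => ?_)
  have h₁ : Real.exp (|s.re| * |y|) * Real.exp (|s.re| * |y|) =
      Real.exp (2 * a * |y|) * Real.exp (-(2 * (a - |s.re|)) * |y|) := by
    rw [← Real.exp_add, ← Real.exp_add]; ring_nf
  have h₂ : Real.exp (4 * a * |y|) = Real.exp (2 * a * |y|) ^ 2 := by
    rw [← Real.exp_nat_mul]; ring_nf
  have h₃ : Real.exp (-(4 * (a - |s.re|)) * |y|) =
      Real.exp (-(2 * (a - |s.re|)) * |y|) ^ 2 := by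
    rw [← Real.exp_nat_mul]; ring_nf
  rw [norm_mul, norm_mul]
  calc ‖Complex.exp (s * y)‖ * ‖V y‖ * ‖μ y‖
      ≤ Real.exp (|s.re| * |y|) * ‖V y‖ * (C * Real.exp (|s.re| * |y|)) := by
        gcongr
        · exact norm_exp_mul_le s y
        · exact hC y
    _ = C * (Real.exp (2 * a * |y|) * ‖V y‖ * Real.exp (-(2 * (a - |s.re|)) * |y|)) := by
        linear_combination C * ‖V y‖ * h₁
    _ ≤ C * (Real.exp (4 * a * |y|) * ‖V y‖ ^ 2 + Real.exp (-(4 * (a - |s.re|)) * |y|)) := by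
        gcongr
        rw [h₂, h₃]
        nlinarith [sq_nonneg (Real.exp (2 * a * |y|) * ‖V y‖ -
          Real.exp (-(2 * (a - |s.re|)) * |y|)), sq_nonneg (Real.exp (2 * a * |y|) * ‖V y‖),
          sq_nonneg (Real.exp (-(2 * (a - |s.re|)) * |y|))]

theorem isAdmissible_of_growth {a : ℝ} {V μ : ℝ → ℂ} {t : ℂ} {C : ℝ} (hV : Continuous V)
    (hμ : Continuous μ) (hVL2 : Integrable fun x : ℝ => Real.exp (4 * a * |x|) * ‖V x‖ ^ 2)
    (ht : |t.re| < a) (hC : ∀ x, ‖μ x‖ ≤ C * Real.exp (|t.re| * |x|)) : IsAdmissible t V μ :=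
  ⟨fun _ => (integrable_exp_mul_of_growth (s := -t) hV hμ hVL2 (by simpa using ht)
      (by simpa using hC)).integrableOn,
    fun _ => (integrable_exp_mul_of_growth hV hμ hVL2 ht hC).integrableOn⟩

theorem integrable_norm_sq_mul_exp_of_growth {a r C : ℝ} {μ : ℝ → ℂ} (hμ : Continuous μ)
    (hr : r < a) (hC : ∀ x, ‖μ x‖ ≤ C * Real.exp (r * |x|)) :
    Integrable fun x : ℝ => ‖μ x‖ ^ 2 * Real.exp (-2 * a * |x|) := by
  have hb : 0 < 2 * (a - r) := by linarith
  refine ((integrable_exp_neg_mul_abs hb).const_mul (C ^ 2)).mono' (by fun_prop)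
    (ae_of_all _ fun x => ?_)
  rw [Real.norm_of_nonneg (by positivity)]
  calc ‖μ x‖ ^ 2 * Real.exp (-2 * a * |x|)
      ≤ (C * Real.exp (r * |x|)) ^ 2 * Real.exp (-2 * a * |x|) := by gcongr; exact hC x
    _ = C ^ 2 * Real.exp (-(2 * (a - r)) * |x|) := by
        rw [mul_pow, ← Real.exp_nat_mul, mul_assoc, ← Real.exp_add]; ring_nf

theorem isSolution_of_contDiff {t lam : ℂ} {V ν : ℝ → ℂ} (hlam : lam = -t ^ 2)
    (hν : ContDiff ℝ 2 ν) (hode : ∀ x : ℝ, deriv (deriv ν) x + (lam - V x) * ν x = 0) :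
    IsSolution t V ν (deriv ν) := fun x =>
  ⟨(hν.differentiable two_ne_zero x).hasDerivAt,
    ((hν.differentiable_deriv_two x).hasDerivAt).congr_deriv
      (by linear_combination hode x - ν x * hlam)⟩

/-- Let `a > 0`, `V` continuous with `e^{2a|x|}V ∈ L²(ℝ)`, `t ≠ 0`,
`|Re t| < a`, `λ = -t²`, and let `ν₁, ν₂` be the C² solutions of `μ'' + (λ-V)μ = 0`
with initial data `ν₁(0)=1, ν₁'(0)=0, ν₂(0)=0, ν₂'(0)=1` and growth bound
`|νᵢ(x)| + |νᵢ'(x)| ≤ C e^{|Re t||x|}`.  Then `𝔻(λ,ν₁,ν₂)` is well defined (the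
integrals converge), and `𝔻(λ,ν₁,ν₂) = 0` iff there is a nonzero continuous
`μ ∈ L²(ℝ, e^{-2a|x|}dx)` satisfying the generalized eigenfunction integral equation. -/
theorem statement10 (a : ℝ) (ha : 0 < a) (V : ℝ → ℂ) (hV : Continuous V)
    (hVL2 : Integrable (fun x : ℝ => Real.exp (4 * a * |x|) * ‖V x‖ ^ 2))
    (t : ℂ) (ht : t ≠ 0) (htre : |t.re| < a) (lam : ℂ) (hlam : lam = -t ^ 2)
    (ν₁ ν₂ : ℝ → ℂ) (hν₁ : ContDiff ℝ 2 ν₁) (hν₂ : ContDiff ℝ 2 ν₂)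
    (hodeν₁ : ∀ x : ℝ, deriv (deriv ν₁) x + (lam - V x) * ν₁ x = 0)
    (hodeν₂ : ∀ x : ℝ, deriv (deriv ν₂) x + (lam - V x) * ν₂ x = 0)
    (hinit₁ : ν₁ 0 = 1 ∧ deriv ν₁ 0 = 0) (hinit₂ : ν₂ 0 = 0 ∧ deriv ν₂ 0 = 1)
    (hgrow : ∃ C : ℝ, ∀ x : ℝ,
      ‖ν₁ x‖ + ‖deriv ν₁ x‖ ≤ C * Real.exp (|t.re| * |x|) ∧
      ‖ν₂ x‖ + ‖deriv ν₂ x‖ ≤ C * Real.exp (|t.re| * |x|)) :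
    ((∀ x : ℝ, IntegrableOn (fun y : ℝ => Complex.exp (-t * y) * V y * ν₁ y) (Ici x)) ∧
     (∀ x : ℝ, IntegrableOn (fun y : ℝ => Complex.exp (t * y) * V y * ν₁ y) (Iic x)) ∧
     (∀ x : ℝ, IntegrableOn (fun y : ℝ => Complex.exp (-t * y) * V y * ν₂ y) (Ici x)) ∧
     (∀ x : ℝ, IntegrableOn (fun y : ℝ => Complex.exp (t * y) * V y * ν₂ y) (Iic x))) ∧
    (DD t V ν₁ ν₂ = 0 ↔
      ∃ μ : ℝ → ℂ, Continuous μ ∧ (∃ x : ℝ, μ x ≠ 0) ∧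
        Integrable (fun x : ℝ => ‖μ x‖ ^ 2 * Real.exp (-2 * a * |x|)) ∧
        (∀ x : ℝ, IntegrableOn (fun y : ℝ => Complex.exp (-t * y) * V y * μ y) (Ici x)) ∧
        (∀ x : ℝ, IntegrableOn (fun y : ℝ => Complex.exp (t * y) * V y * μ y) (Iic x)) ∧
        (∀ x : ℝ, μ x =
          -(1 / (2 * t)) * (∫ y in Ici x, Complex.exp (-t * ((y : ℂ) - (x : ℂ))) * V y * μ y)
          - (1 / (2 * t)) * (∫ y in Iic x, Complex.exp (t * ((y : ℂ) - (x : ℂ))) * V y * μ y))) := by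
  obtain ⟨C, hC⟩ := hgrow
  have hg₁ (x : ℝ) : ‖ν₁ x‖ ≤ C * Real.exp (|t.re| * |x|) :=
    (le_add_of_nonneg_right (norm_nonneg _)).trans (hC x).1
  have hg₂ (x : ℝ) : ‖ν₂ x‖ ≤ C * Real.exp (|t.re| * |x|) :=
    (le_add_of_nonneg_right (norm_nonneg _)).trans (hC x).2
  have hs₁ := isSolution_of_contDiff hlam hν₁ hodeν₁
  have hs₂ := isSolution_of_contDiff hlam hν₂ hodeν₂
  have hi₁ := isAdmissible_of_growth hV hν₁.continuous hVL2 htre hg₁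
  have hi₂ := isAdmissible_of_growth hV hν₂.continuous hVL2 htre hg₂
  have hderiv (b c : ℂ) : deriv (D t V fun y => b * ν₁ y + c * ν₂ y) 0 =
      b * deriv (D t V ν₁) 0 + c * deriv (D t V ν₂) 0 := by
    have d₁ := (hasDerivAt_D ht hV hν₁.continuous hi₁ (hs₁ 0).1).differentiableAt.hasDerivAt
    have d₂ := (hasDerivAt_D ht hV hν₂.continuous hi₂ (hs₂ 0).1).differentiableAt.hasDerivAt
    rw [show D t V (fun y => b * ν₁ y + c * ν₂ y) = _ from funext (D_linear hi₁ hi₂ b c)]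
    exact ((d₁.const_mul b).add (d₂.const_mul c)).deriv
  refine ⟨⟨hi₁.1, hi₁.2, hi₂.1, hi₂.2⟩, fun hDD => ?_, ?_⟩
  · obtain ⟨b, c, hbc, h₀, h₁⟩ := exists_linear_eq_zero hDD
    have hs := hs₁.linear hs₂ b c
    have hi := hi₁.linear hi₂ b c
    have hD := hs.D_eq_zero ht hV hi (by rw [D_linear hi₁ hi₂, h₀]) (by rw [hderiv, h₁])
    have hgrow (x : ℝ) :
        ‖b * ν₁ x + c * ν₂ x‖ ≤ ((‖b‖ + ‖c‖) * C) * Real.exp (|t.re| * |x|) :=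
      calc ‖b * ν₁ x + c * ν₂ x‖ ≤ ‖b‖ * ‖ν₁ x‖ + ‖c‖ * ‖ν₂ x‖ := by
            simpa only [norm_mul] using norm_add_le (b * ν₁ x) (c * ν₂ x)
        _ ≤ ‖b‖ * (C * Real.exp (|t.re| * |x|)) + ‖c‖ * (C * Real.exp (|t.re| * |x|)) := by
            gcongr
            · exact hg₁ x
            · exact hg₂ x
        _ = _ := by ring
    refine ⟨_, hs.continuous, ?_, integrable_norm_sq_mul_exp_of_growth hs.continuous htre hgrow,
      hi.1, hi.2, fun x => ?_⟩
    · by_contra! hzero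
      have hb : b = 0 := by simpa [hinit₁.1, hinit₂.1] using hzero 0
      have hc : c = 0 := by
        have h := (hs 0).1.deriv
        rw [funext hzero] at h
        simpa [hinit₁.2, hinit₂.2] using h.symm
      exact hbc.elim (· hb) (· hc)
    · have h := hD x
      rw [D] at h
      linear_combination h
  · rintro ⟨μ, hμ, ⟨x₀, hx₀⟩, -, hr, hl, heq⟩
    have hD (x : ℝ) : D t V μ x = 0 := by
      rw [D]
      linear_combination heq x
    have hs := isSolution_of_D_eq_zero ht hV hμ ⟨hr, hl⟩ hD
    set μ' : ℝ → ℂ := fun x => -((rightPart t V μ x - leftPart t V μ x) / 2)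
    have hlin : μ = fun y => μ 0 * ν₁ y + μ' 0 * ν₂ y :=
      funext (hs.eq_linear hs₁ hs₂ hinit₁ hinit₂)
    have h₀ := D_linear hi₁ hi₂ (μ 0) (μ' 0) 0
    have h₁ := hderiv (μ 0) (μ' 0)
    rw [← hlin, hD] at h₀
    rw [← hlin, funext hD, deriv_const] at h₁
    by_contra hne
    have hb : μ 0 * DD t V ν₁ ν₂ = 0 := by
      rw [DD]
      linear_combination D t V ν₂ 0 * h₁ - deriv (D t V ν₂) 0 * h₀
    have hc : μ' 0 * DD t V ν₁ ν₂ = 0 := by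
      rw [DD]
      linear_combination deriv (D t V ν₁) 0 * h₀ - D t V ν₁ 0 * h₁
    apply hx₀
    rw [hs.eq_linear hs₁ hs₂ hinit₁ hinit₂ x₀, (mul_eq_zero.1 hb).resolve_right hne,
      (mul_eq_zero.1 hc).resolve_right hne]
    ring
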